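/- For every finite nonempty S ⊆ ℝ^d and every point b ∈ ℝ^d with dist(b,μ) ≤ 3r, it holds that Cost(A, S ∪ {b}) ≤ γ_z·T. -/

import Mathlib

/-- `cost z w A S = Σ_{x ∈ A} w(x) · dist(x,S)^z`, with `dist(x,S)` the infimum distance
from `x` to the set `S` and the power a real power. -/
noncomputable def cost {dim : ℕ} (z : ℝ) (w : EuclideanSpace ℝ (Fin dim) → ℝ)
    (A : Finset (EuclideanSpace ℝ (Fin dim))) (S : Set (EuclideanSpace ℝ (Fin dim))) : ℝ :=
  ∑ x ∈ A, w x * Metric.infDist x S ^ z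

theorem add_rpow_le_two_mul_rpow_add {z a c : ℝ} (hz : 1 ≤ z) (ha : 0 ≤ a) (hc : 0 ≤ c) :
    (a + c) ^ z ≤ 2 * a ^ z + (1 + 2 * z) ^ z * c ^ z := by
  have hz0 : 0 < z := by linarith
  have haz : 0 ≤ a ^ z := Real.rpow_nonneg ha z
  have hcz : 0 ≤ (1 + 2 * z) ^ z * c ^ z := by positivity
  rcases le_total (2 * z * c) a with h | h
  · have hexp : Real.exp (1 / 2) ≤ 2 := by
      have hsq : Real.exp (1 / 2) * Real.exp (1 / 2) = Real.exp 1 := by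
        rw [← Real.exp_add]; norm_num
      have he := Real.exp_one_lt_d9
      nlinarith [Real.exp_pos (1 / 2)]
    have hle : a + c ≤ Real.exp (1 / (2 * z)) * a := by
      have hca : c ≤ 1 / (2 * z) * a := by
        rw [div_mul_eq_mul_div, le_div_iff₀ (by positivity)]
        linarith
      nlinarith [mul_le_mul_of_nonneg_right (Real.add_one_le_exp (1 / (2 * z))) ha]
    calc (a + c) ^ z ≤ (Real.exp (1 / (2 * z)) * a) ^ z :=
          Real.rpow_le_rpow (by positivity) hle hz0.le
      _ = Real.exp (1 / 2) * a ^ z := by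
          rw [Real.mul_rpow (Real.exp_pos _).le ha, ← Real.exp_mul]
          congr 2
          field_simp
      _ ≤ 2 * a ^ z + (1 + 2 * z) ^ z * c ^ z := by nlinarith
  · calc (a + c) ^ z ≤ ((1 + 2 * z) * c) ^ z :=
          Real.rpow_le_rpow (by positivity) (by linarith) hz0.le
      _ = (1 + 2 * z) ^ z * c ^ z := Real.mul_rpow (by positivity) hc
      _ ≤ 2 * a ^ z + (1 + 2 * z) ^ z * c ^ z := by linarith

/-- With `T = Σ_{x∈A} w(x)·dist(x,μ)^z`, `m = Σ_{x∈A} w(x) > 0`, `r = (T/m)^{1/z}` and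
`γ_z = 2 + 3^z(1+2z)^z`: for every finite nonempty `S` and every point `b` with
`dist(b,μ) ≤ 3r`, we have `Cost(A, S ∪ {b}) ≤ γ_z · T`. -/
theorem stmt4 {dim : ℕ} (z : ℝ) (hz : 1 ≤ z)
    (A : Finset (EuclideanSpace ℝ (Fin dim)))
    (w : EuclideanSpace ℝ (Fin dim) → ℝ) (hw : ∀ x ∈ A, 0 ≤ w x)
    (hm : 0 < ∑ x ∈ A, w x) (μ : EuclideanSpace ℝ (Fin dim))
    (S : Finset (EuclideanSpace ℝ (Fin dim))) (hS : S.Nonempty)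
    (b : EuclideanSpace ℝ (Fin dim))
    (hb : dist b μ ≤ 3 * ((∑ x ∈ A, w x * dist x μ ^ z) / ∑ x ∈ A, w x) ^ (1 / z)) :
    cost z w A (insert b (↑S : Set (EuclideanSpace ℝ (Fin dim)))) ≤
      (2 + 3 ^ z * (1 + 2 * z) ^ z) * (∑ x ∈ A, w x * dist x μ ^ z) := by
  have hz0 : 0 < z := by linarith
  set m := ∑ x ∈ A, w x with hm_def
  set T := ∑ x ∈ A, w x * dist x μ ^ z with hT_def
  have hT : 0 ≤ T := Finset.sum_nonneg fun x hx =>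
    mul_nonneg (hw x hx) (Real.rpow_nonneg dist_nonneg z)
  set r := (T / m) ^ (1 / z) with hr_def
  have hr : 0 ≤ r := by positivity
  have hrz : m * r ^ z = T := by
    rw [hr_def, ← Real.rpow_mul (by positivity), one_div_mul_cancel hz0.ne', Real.rpow_one]
    field_simp
  have hpoint : ∀ x ∈ A, w x * Metric.infDist x (insert b (↑S : Set _)) ^ z ≤
      2 * (w x * dist x μ ^ z) + w x * ((1 + 2 * z) ^ z * (3 * r) ^ z) := by
    intro x hx
    have hdist : Metric.infDist x (insert b (↑S : Set _)) ≤ dist x μ + 3 * r :=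
      calc Metric.infDist x (insert b (↑S : Set _)) ≤ dist x b :=
            Metric.infDist_le_dist_of_mem (Set.mem_insert _ _)
        _ ≤ dist x μ + dist b μ := dist_triangle_right _ _ _
        _ ≤ dist x μ + 3 * r := by gcongr
    calc w x * Metric.infDist x (insert b (↑S : Set _)) ^ z
        ≤ w x * (2 * dist x μ ^ z + (1 + 2 * z) ^ z * (3 * r) ^ z) :=
          mul_le_mul_of_nonneg_left
            ((Real.rpow_le_rpow Metric.infDist_nonneg hdist hz0.le).trans
              (add_rpow_le_two_mul_rpow_add hz dist_nonneg (by positivity))) (hw x hx)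
      _ = _ := by ring
  calc cost z w A (insert b (↑S : Set (EuclideanSpace ℝ (Fin dim))))
      ≤ ∑ x ∈ A, (2 * (w x * dist x μ ^ z) + w x * ((1 + 2 * z) ^ z * (3 * r) ^ z)) :=
        Finset.sum_le_sum hpoint
    _ = 2 * T + m * ((1 + 2 * z) ^ z * (3 * r) ^ z) := by
        rw [Finset.sum_add_distrib, ← Finset.mul_sum, ← Finset.sum_mul]
    _ = 2 * T + 3 ^ z * (1 + 2 * z) ^ z * (m * r ^ z) := by
        rw [Real.mul_rpow (by norm_num) hr]; ring
    _ = (2 + 3 ^ z * (1 + 2 * z) ^ z) * T := by rw [hrz]; ring
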